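/- (Case λ ≠ 0, μ ≠ 0, λ ≠ μ: nonexistence.) There exist no real constants λ, μ with λ ≠ 0, μ ≠ 0 and λ ≠ μ, and smooth p, q, φ as in the setup, such that on (a,b): sin φ + 1/sin φ + (φ'' cos φ)/(2φ'²) − (H cos²φ)/(φ' sin φ) = λ p and −(3/2)cos φ + (φ'' sin φ)/(2φ'²) − (sin φ cos φ)/(2 p φ') = μ q. -/

import Mathlib

open Real Set

open Topology in
/-- A function that vanishes on an open set has zero derivative there. -/
theorem hasDerivAt_eq_zero_of_isOpen {f : ℝ → ℝ} {f' u : ℝ} {U : Set ℝ} (hU : IsOpen U)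
    (hu : u ∈ U) (h : ∀ v ∈ U, f v = 0) (hf : HasDerivAt f f' u) : f' = 0 := by
  have h0 : f =ᶠ[𝓝 u] fun _ => 0 := Filter.eventually_of_mem (hU.mem_nhds hu) h
  exact hf.unique ((hasDerivAt_const u (0 : ℝ)).congr_of_eventuallyEq h0)

/-- The two coordinate equations, solved for `λ p sin φ - μ q cos φ`. -/
theorem support_eq_two {s c p q A B H lam mu : ℝ} (hsc : s ^ 2 + c ^ 2 = 1) (hs : s ≠ 0)
    (hA : A ≠ 0) (hp : p ≠ 0) (hH : 2 * H = A + s / p)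
    (h1 : s + 1 / s + B * c / (2 * A ^ 2) - H * c ^ 2 / (A * s) = lam * p)
    (h2 : -(3 / 2) * c + B * s / (2 * A ^ 2) - s * c / (2 * p * A) = mu * q) :
    lam * p * s - mu * q * c - 2 = 0 := by
  obtain rfl : H = (A + s / p) / 2 := by linarith
  rw [← h1, ← h2]
  field_simp
  linear_combination 2 * A ^ 2 * p * hsc

/-- The two coordinate equations, solved for `λ p cos φ + μ q sin φ`. -/
theorem tangential_eq {s c p q A B H lam mu : ℝ} (hsc : s ^ 2 + c ^ 2 = 1) (hs : s ≠ 0)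
    (hA : A ≠ 0) (hp : p ≠ 0) (hH : 2 * H = A + s / p)
    (h1 : s + 1 / s + B * c / (2 * A ^ 2) - H * c ^ 2 / (A * s) = lam * p)
    (h2 : -(3 / 2) * c + B * s / (2 * A ^ 2) - s * c / (2 * p * A) = mu * q) :
    B * s * p - c * A * s + c * A ^ 2 * p = 2 * A ^ 2 * s * p * (lam * p * c + mu * q * s) := by
  obtain rfl : H = (A + s / p) / 2 := by linarith
  rw [← h1, ← h2]
  field_simp
  have hs2 : s ^ 2 = 1 - c ^ 2 := by linarith
  simp only [hs2, pow_succ, pow_zero, one_mul]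
  ring

/-- Elimination of `p` and of the second derivative of `φ`. -/
theorem cubic_factorization {s c p A B lam δ : ℝ} (hsc : s ^ 2 + c ^ 2 = 1) (hs : s ≠ 0)
    (hc : c ≠ 0) (hA : A ≠ 0)
    (h3 : B * s * p = A * c * (s - A * p + 2 * δ * s ^ 2 * p))
    (h4 : A * (lam * p - 2 * s) = δ * s * c ^ 2)
    (h5 : B * (lam * p - 2 * s) + A * (lam * c - 2 * c * A)
      = δ * (c * A * c ^ 2 - 2 * s ^ 2 * c * A)) :
    (A + δ * c ^ 2) *
      (2 * A ^ 2 + A * (3 * δ * c ^ 2 - 2 * δ - lam) - δ ^ 2 * c ^ 2 * s ^ 2) = 0 := by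
  have e1 : δ * c ^ 2 * (s - A * p + 2 * δ * s ^ 2 * p) + p * (lam * A - 2 * A ^ 2)
      = p * δ * A * (c ^ 2 - 2 * s ^ 2) := by
    apply mul_left_cancel₀ (mul_ne_zero hA hc)
    linear_combination p * A * h5 - B * p * h4 - δ * c ^ 2 * h3
  have e2 : lam * δ * c ^ 2 * A + (2 * A + δ * c ^ 2) * (-(δ * c ^ 2 * A)
      + 2 * δ ^ 2 * s ^ 2 * c ^ 2 + lam * A - 2 * A ^ 2 - δ * A * (c ^ 2 - 2 * s ^ 2)) = 0 := by
    apply mul_left_cancel₀ hs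
    linear_combination lam * A * e1 - (-(δ * c ^ 2 * A)
      + 2 * δ ^ 2 * s ^ 2 * c ^ 2 + lam * A - 2 * A ^ 2 - δ * A * (c ^ 2 - 2 * s ^ 2)) * h4
  have hs2 : s ^ 2 = 1 - c ^ 2 := by linarith
  rw [hs2] at e2 ⊢
  linear_combination (-1 / 2) * e2

/-- The quadratic factor of the cubic relation and its derivative force `λ (λ + δ) = 0`. -/
theorem quadratic_factor_incompatible {s c p A B lam δ : ℝ} (hsc : s ^ 2 + c ^ 2 = 1)
    (hs : s ≠ 0) (hc : c ≠ 0) (hA : A ≠ 0) (hp : p ≠ 0) (hlam : lam ≠ 0) (hδ : δ ≠ 0)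
    (h3 : B * s * p = A * c * (s - A * p + 2 * δ * s ^ 2 * p))
    (h4 : A * (lam * p - 2 * s) = δ * s * c ^ 2)
    (hQ : 2 * A ^ 2 + A * (3 * δ * c ^ 2 - 2 * δ - lam) - δ ^ 2 * c ^ 2 * s ^ 2 = 0)
    (hQ' : B * (4 * A + 3 * δ * c ^ 2 - 2 * δ - lam)
      = 2 * c * s * A * (3 * δ * A + δ ^ 2 * (c ^ 2 - s ^ 2))) :
    lam * (lam + δ) = 0 := by
  have hs2 : s ^ 2 = 1 - c ^ 2 := by linarith
  have hW : 2 * A + δ * c ^ 2 ≠ 0 := by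
    intro h
    have : lam * p * A = 0 := by linear_combination h4 + s * h
    simp_all
  have e3 : B * s * (2 * A + δ * c ^ 2)
      = A * c * (lam * A + (2 * δ * s ^ 2 - A) * (2 * A + δ * c ^ 2)) := by
    apply mul_left_cancel₀ hs
    linear_combination lam * A * h3
      - (B * s - A * c * (2 * δ * s ^ 2 - A)) * h4
  have e4 : (lam * A + (2 * δ * s ^ 2 - A) * (2 * A + δ * c ^ 2))
      = δ * s ^ 2 * (2 * A + δ * c ^ 2) := by
    rw [hs2] at hQ ⊢
    linear_combination -hQ
  have e5 : 2 * A + δ * c ^ 2 + lam = 0 := by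
    have h : (A * c * δ * s ^ 2 * (2 * A + δ * c ^ 2)) * (2 * A + δ * c ^ 2 + lam) = 0 := by
      rw [e4] at e3
      have hd : 2 * (c ^ 2 - s ^ 2) = 4 * c ^ 2 - 2 := by linarith
      linear_combination (4 * A + 3 * δ * c ^ 2 - 2 * δ - lam) * e3
        - s * (2 * A + δ * c ^ 2) * hQ' - A * c * δ ^ 2 * s ^ 2 * (2 * A + δ * c ^ 2) * hd
    exact (mul_eq_zero.mp h).resolve_left (by positivity)
  rw [hs2] at hQ
  obtain rfl : A = -(δ * c ^ 2 + lam) / 2 := by linarith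
  linear_combination hQ

/-- Case λ ≠ 0, μ ≠ 0, λ ≠ μ: there exist no such constants and smooth `p, q, φ` as in
the setup with `Δ^II(p cos v)/cos v = λ p` and `Δ^II(q) = μ q` on `(a,b)`. -/
theorem case_V_nonexistence
    {a b : ℝ} (hab : a < b) :
    ¬ ∃ (lam mu : ℝ) (p q φ H : ℝ → ℝ),
      lam ≠ 0 ∧ lam ≠ mu ∧
      mu ≠ 0 ∧ ContDiff ℝ (⊤ : ℕ∞) p ∧ ContDiff ℝ (⊤ : ℕ∞) q ∧ ContDiff ℝ (⊤ : ℕ∞) φ ∧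
      (∀ u ∈ Ioo a b, 0 < p u) ∧
      (∀ u ∈ Ioo a b, deriv p u = Real.cos (φ u)) ∧
      (∀ u ∈ Ioo a b, deriv q u = Real.sin (φ u)) ∧
      (∀ u ∈ Ioo a b, deriv φ u ≠ 0) ∧
      (∀ u ∈ Ioo a b, Real.sin (φ u) ≠ 0) ∧
      (∀ u ∈ Ioo a b, 2 * H u = deriv φ u + Real.sin (φ u) / p u) ∧
      (∀ u ∈ Ioo a b, Real.sin (φ u) + 1 / Real.sin (φ u)
            + deriv (deriv φ) u * Real.cos (φ u) / (2 * deriv φ u ^ 2)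
            - H u * Real.cos (φ u) ^ 2 / (deriv φ u * Real.sin (φ u)) = lam * p u) ∧
      (∀ u ∈ Ioo a b, -(3 / 2) * Real.cos (φ u)
            + deriv (deriv φ) u * Real.sin (φ u) / (2 * deriv φ u ^ 2)
            - Real.sin (φ u) * Real.cos (φ u) / (2 * p u * deriv φ u) = mu * q u) := by
  rintro ⟨lam, mu, p, q, φ, H, hlam, hne, hmu, hp, hq, hφ, hpos, hp', hq', hA, hs, hH, h1, h2⟩
  have hδ : mu - lam ≠ 0 := sub_ne_zero.mpr hne.symm
  have hsc : ∀ u, sin (φ u) ^ 2 + cos (φ u) ^ 2 = 1 := fun u => sin_sq_add_cos_sq _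
  have dp : ∀ u ∈ Ioo a b, HasDerivAt p (cos (φ u)) u := fun u hu =>
    hp' u hu ▸ (hp.differentiable (by simp) u).hasDerivAt
  have dq : ∀ u ∈ Ioo a b, HasDerivAt q (sin (φ u)) u := fun u hu =>
    hq' u hu ▸ (hq.differentiable (by simp) u).hasDerivAt
  have dφ : ∀ u, HasDerivAt φ (deriv φ u) u := fun u =>
    (hφ.differentiable (by simp) u).hasDerivAt
  have dA : ∀ u, HasDerivAt (deriv φ) (deriv (deriv φ) u) u := fun u =>
    ((contDiff_infty_iff_deriv.mp hφ).2.differentiable (by simp) u).hasDerivAt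
  have ds : ∀ u, HasDerivAt (fun v => sin (φ v)) (cos (φ u) * deriv φ u) u := fun u => (dφ u).sin
  have dc : ∀ u, HasDerivAt (fun v => cos (φ v)) (-sin (φ u) * deriv φ u) u := fun u => (dφ u).cos
  have L1 : ∀ u ∈ Ioo a b, lam * p u * sin (φ u) - mu * q u * cos (φ u) - 2 = 0 := fun u hu =>
    support_eq_two (hsc u) (hs u hu) (hA u hu) (hpos u hu).ne' (hH u hu) (h1 u hu) (h2 u hu)
  have L2 : ∀ u ∈ Ioo a b, deriv φ u * (lam * p u * cos (φ u) + mu * q u * sin (φ u))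
      = (mu - lam) * sin (φ u) * cos (φ u) := by
    intro u hu
    have := hasDerivAt_eq_zero_of_isOpen isOpen_Ioo hu L1
      (((((dp u hu).const_mul lam).mul (ds u)).sub
        (((dq u hu).const_mul mu).mul (dc u))).sub_const 2)
    linear_combination this
  have L3 : ∀ u ∈ Ioo a b, deriv (deriv φ) u * sin (φ u) * p u = deriv φ u * cos (φ u) *
      (sin (φ u) - deriv φ u * p u + 2 * (mu - lam) * sin (φ u) ^ 2 * p u) := by
    intro u hu
    linear_combination tangential_eq (hsc u) (hs u hu) (hA u hu) (hpos u hu).ne' (hH u hu)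
      (h1 u hu) (h2 u hu) + 2 * deriv φ u * sin (φ u) * p u * L2 u hu
  have L4 : ∀ u ∈ Ioo a b, deriv φ u * (lam * p u - 2 * sin (φ u))
      - (mu - lam) * (sin (φ u) * cos (φ u) ^ 2) = 0 := by
    intro u hu
    linear_combination cos (φ u) * L2 u hu + sin (φ u) * deriv φ u * L1 u hu
      - deriv φ u * lam * p u * hsc u
  have L5 : ∀ u ∈ Ioo a b, deriv (deriv φ) u * (lam * p u - 2 * sin (φ u))
      + deriv φ u * (lam * cos (φ u) - 2 * cos (φ u) * deriv φ u)
      = (mu - lam) * (cos (φ u) * deriv φ u * cos (φ u) ^ 2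
        - 2 * sin (φ u) ^ 2 * cos (φ u) * deriv φ u) := by
    intro u hu
    have := hasDerivAt_eq_zero_of_isOpen isOpen_Ioo hu L4
      (((dA u).mul (((dp u hu).const_mul lam).sub ((ds u).const_mul 2))).sub
        (((ds u).mul ((dc u).pow 2)).const_mul (mu - lam)))
    simp only [Pi.sub_apply, Pi.pow_apply] at this
    norm_num at this
    linear_combination this
  have L4' : ∀ u ∈ Ioo a b, deriv φ u * (lam * p u - 2 * sin (φ u))
      = (mu - lam) * sin (φ u) * cos (φ u) ^ 2 := fun u hu => by
    linear_combination L4 u hu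
  have hcφ : Continuous φ := hφ.continuous
  have hcA : Continuous (deriv φ) := continuous_iff_continuousAt.mpr fun u => (dA u).continuousAt
  set U : Set ℝ := Ioo a b ∩ {u | cos (φ u) ≠ 0}
  have hU : IsOpen U := isOpen_Ioo.inter (isOpen_ne_fun (by fun_prop) (by fun_prop))
  obtain ⟨w, hw⟩ : U.Nonempty := by
    by_contra hempty
    obtain ⟨m, hm⟩ := nonempty_Ioo.mpr hab
    have h0 : ∀ u ∈ Ioo a b, cos (φ u) = 0 := fun u hu => by
      by_contra hne0
      exact hempty ⟨u, hu, hne0⟩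
    have := hasDerivAt_eq_zero_of_isOpen isOpen_Ioo hm h0 (dc m)
    exact mul_ne_zero (neg_ne_zero.mpr (hs m hm)) (hA m hm) this
  have hlin : ∀ u ∈ U, deriv φ u + (mu - lam) * cos (φ u) ^ 2 = 0 := by
    intro u hu
    by_contra hne0
    set V : Set ℝ := U ∩ {v | deriv φ v + (mu - lam) * cos (φ v) ^ 2 ≠ 0}
    have hV : IsOpen V := hU.inter (isOpen_ne_fun (by fun_prop) (by fun_prop))
    have hQ : ∀ v ∈ V, 2 * deriv φ v ^ 2
        + deriv φ v * (3 * (mu - lam) * cos (φ v) ^ 2 - 2 * (mu - lam) - lam)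
        - (mu - lam) ^ 2 * cos (φ v) ^ 2 * sin (φ v) ^ 2 = 0 := fun v hv =>
      (mul_eq_zero.mp (cubic_factorization (hsc v) (hs v hv.1.1) hv.1.2 (hA v hv.1.1)
        (L3 v hv.1.1) (L4' v hv.1.1) (L5 v hv.1.1))).resolve_left hv.2
    have huV : u ∈ V := ⟨hu, hne0⟩
    have hQ' := hasDerivAt_eq_zero_of_isOpen hV huV hQ
      (((((dA u).pow 2).const_mul 2).add ((dA u).mul
        (((((dc u).pow 2).const_mul (3 * (mu - lam))).sub_const (2 * (mu - lam))).sub_const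
          lam))).sub
        ((((dc u).pow 2).const_mul ((mu - lam) ^ 2)).mul ((ds u).pow 2)))
    simp only [Pi.pow_apply] at hQ'
    norm_num at hQ'
    have := quadratic_factor_incompatible (hsc u) (hs u hu.1) hu.2 (hA u hu.1)
      (hpos u hu.1).ne' hlam hδ (L3 u hu.1) (L4' u hu.1) (hQ u huV)
      (by linear_combination hQ')
    rw [add_sub_cancel] at this
    exact mul_ne_zero hlam hmu this
  have hlin' : ∀ u ∈ U, deriv (deriv φ) u
      = 2 * (mu - lam) * cos (φ u) * sin (φ u) * deriv φ u := by
    intro u hu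
    have := hasDerivAt_eq_zero_of_isOpen hU hu hlin
      ((dA u).add (((dc u).pow 2).const_mul (mu - lam)))
    norm_num at this
    linear_combination this
  have hconst : ∀ u ∈ U, deriv φ u - lam = 0 := by
    intro u hu
    have hAp : deriv φ u * p u = sin (φ u) := by
      apply mul_left_cancel₀ (mul_ne_zero (hA u hu.1) hu.2)
      linear_combination L3 u hu.1 - sin (φ u) * p u * hlin' u hu
    have hlp : lam * p u = sin (φ u) := by
      apply mul_left_cancel₀ (hA u hu.1)
      linear_combination L4' u hu.1 + sin (φ u) * hlin u hu
    apply (mul_eq_zero.mp (?_ : (deriv φ u - lam) * p u = 0)).resolve_right (hpos u hu.1).ne'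
    linear_combination hAp - hlp
  have h0 := hasDerivAt_eq_zero_of_isOpen hU hw hconst ((dA w).sub_const lam)
  rw [hlin' w hw] at h0
  exact mul_ne_zero (mul_ne_zero (mul_ne_zero (mul_ne_zero two_ne_zero hδ) hw.2) (hs w hw.1))
    (hA w hw.1) h0
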